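/- arXiv:2501.11422 — 2 statements merged into one kernel-verified Lean document; each statement's English description precedes it below -/
import Mathlib

section
/- Let Y be a real symmetric I×I matrix with eigenvalues λ_1 ≥ λ_2 ≥ … ≥ λ_I, and let E be the number of indices i with λ_i ≥ 0. For any R ≤ I, the infimum of ‖Y − S‖² over all positive semi-definite matrices S ∈ ℝ^{I×I} with rank(S) ≤ R equals Σ_{i=min(R,E)+1}^{I} λ_i², and this infimum is attained. -/
open Matrix Finset

namespace Matrix

variable {n : Type*} [Fintype n]

lemma sum_sq_eq_trace (A : Matrix n n ℝ) : ∑ i, ∑ j, A i j ^ 2 = (Aᵀ * A).trace := by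
  rw [Finset.sum_comm]
  simp [Matrix.trace, Matrix.mul_apply, sq]

variable [DecidableEq n]

/-- The Frobenius norm is invariant under orthogonal changes of basis on both sides. -/
lemma sum_sq_orthogonal_mul_mul (U V A : Matrix n n ℝ) (hU : Uᵀ * U = 1) (hV : Vᵀ * V = 1) :
    ∑ i, ∑ j, (U * A * Vᵀ) i j ^ 2 = ∑ i, ∑ j, A i j ^ 2 := by
  have h : (U * A * Vᵀ)ᵀ * (U * A * Vᵀ) = V * (Aᵀ * ((Uᵀ * U) * A) * Vᵀ) := by
    simp only [transpose_mul, transpose_transpose, Matrix.mul_assoc]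
  rw [sum_sq_eq_trace, sum_sq_eq_trace, h, hU, Matrix.one_mul, trace_mul_comm, Matrix.mul_assoc,
    hV, Matrix.mul_one]

/-- The squared Frobenius distance between two orthogonally diagonalized matrices. -/
lemma sum_sq_conj_diagonal_sub (U V : Matrix n n ℝ) (a b : n → ℝ)
    (hU : Uᵀ * U = 1) (hV : Vᵀ * V = 1) :
    ∑ i, ∑ j, ((U * diagonal a * Uᵀ - V * diagonal b * Vᵀ) i j) ^ 2 =
      ∑ i, ∑ k, (a i - b k) ^ 2 * (Uᵀ * V) i k ^ 2 := by
  have hU' : U * Uᵀ = 1 := mul_eq_one_comm.mp hU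
  have hV' : V * Vᵀ = 1 := mul_eq_one_comm.mp hV
  have h : U * diagonal a * Uᵀ - V * diagonal b * Vᵀ =
      U * (diagonal a * (Uᵀ * V) - (Uᵀ * V) * diagonal b) * Vᵀ := by
    have h1 : U * (diagonal a * (Uᵀ * V)) * Vᵀ = U * diagonal a * Uᵀ * (V * Vᵀ) := by
      simp only [Matrix.mul_assoc]
    have h2 : U * ((Uᵀ * V) * diagonal b) * Vᵀ = (U * Uᵀ) * (V * diagonal b * Vᵀ) := by
      simp only [Matrix.mul_assoc]
    rw [Matrix.mul_sub, Matrix.sub_mul, h1, h2, hU', hV', Matrix.mul_one, Matrix.one_mul]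
  rw [h, sum_sq_orthogonal_mul_mul U V _ hU hV]
  refine Finset.sum_congr rfl fun i _ => Finset.sum_congr rfl fun k _ => ?_
  rw [sub_apply, diagonal_mul, mul_diagonal]
  ring

lemma sum_sq_row_of_orthogonal (W : Matrix n n ℝ) (hW : Wᵀ * W = 1) (i : n) :
    ∑ k, W i k ^ 2 = 1 := by
  have h := congrFun (congrFun (mul_eq_one_comm.mp hW : W * Wᵀ = 1) i) i
  simpa [Matrix.mul_apply, sq] using h

lemma sum_sq_col_of_orthogonal (W : Matrix n n ℝ) (hW : Wᵀ * W = 1) (k : n) :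
    ∑ i, W i k ^ 2 = 1 := by
  have h := congrFun (congrFun hW k) k
  simpa [Matrix.mul_apply, sq] using h

end Matrix

/-- A fractional selection of total weight at most `R` from an antitone nonnegative sequence
is dominated by its first `R` terms. -/
lemma sum_mul_le_sum_initial {N R : ℕ} (a w : Fin N → ℝ) (ha : Antitone a) (ha0 : ∀ i, 0 ≤ a i)
    (hw0 : ∀ i, 0 ≤ w i) (hw1 : ∀ i, w i ≤ 1) (hw : ∑ i, w i ≤ R) :
    ∑ i, w i * a i ≤ ∑ i : Fin N, if (i : ℕ) < R then a i else 0 := by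
  rcases le_or_gt N R with hNR | hRN
  · refine Finset.sum_le_sum fun i _ => ?_
    rw [if_pos (i.2.trans_le hNR)]
    exact mul_le_of_le_one_left (ha0 i) (hw1 i)
  · set c := a ⟨R, hRN⟩
    have hterm : ∀ i, w i * (a i - c) ≤ (if (i : ℕ) < R then a i else 0) -
        (if (i : ℕ) < R then c else 0) := by
      intro i
      split_ifs with hi
      · exact mul_le_of_le_one_left (sub_nonneg.2 (ha (Fin.le_def.2 hi.le))) (hw1 i)
      · have : a i ≤ c := ha (Fin.le_def.2 (not_lt.1 hi))
        nlinarith [hw0 i]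
    have hsum := Finset.sum_le_sum fun i (_ : i ∈ Finset.univ) => hterm i
    have hcard : ∑ i : Fin N, (if (i : ℕ) < R then c else 0) = R * c := by
      rw [← Finset.sum_filter, Finset.sum_const, Fin.card_filter_val_lt, min_eq_right hRN.le,
        nsmul_eq_mul]
    rw [Finset.sum_sub_distrib, hcard] at hsum
    simp only [mul_sub, Finset.sum_sub_distrib, ← Finset.sum_mul] at hsum
    nlinarith [mul_le_mul_of_nonneg_right hw (ha0 ⟨R, hRN⟩)]

lemma lt_card_filter_nonneg_iff {N : ℕ} {a : Fin N → ℝ} (ha : Antitone a) (i : Fin N) :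
    (i : ℕ) < (Finset.univ.filter fun j => 0 ≤ a j).card ↔ 0 ≤ a i := by
  constructor
  · intro h
    by_contra! hi
    have hsub : (Finset.univ.filter fun j => 0 ≤ a j) ⊆ Finset.Iio i := by
      intro j hj
      rw [Finset.mem_filter] at hj
      rw [Finset.mem_Iio]
      by_contra! hij
      linarith [ha hij, hj.2]
    have := Finset.card_le_card hsub
    rw [Fin.card_Iio] at this
    omega
  · intro h
    have hsub : Finset.Iic i ⊆ Finset.univ.filter fun j => 0 ≤ a j := fun j hj =>
      Finset.mem_filter.2 ⟨Finset.mem_univ j, h.trans (ha (Finset.mem_Iic.1 hj))⟩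
    have := Finset.card_le_card hsub
    rw [Fin.card_Iic] at this
    omega

/-- The squared-Frobenius-distance infimum over PSD matrices of rank at most `R`
equals the sum of squares of the trailing eigenvalues, and it is attained. -/
theorem stmt1 (I R : ℕ) (hR : R ≤ I)
    (Y U : Matrix (Fin I) (Fin I) ℝ) (lam : Fin I → ℝ)
    (hsym : Yᵀ = Y)
    (hU : Uᵀ * U = 1)
    (hdecomp : Y = U * Matrix.diagonal lam * Uᵀ)
    (hmono : Antitone lam)
    (E : ℕ) (hE : E = (Finset.univ.filter fun i : Fin I => 0 ≤ lam i).card) :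
    IsLeast {v : ℝ | ∃ S : Matrix (Fin I) (Fin I) ℝ, S.PosSemidef ∧ S.rank ≤ R ∧
        v = ∑ i, ∑ j, ((Y - S) i j) ^ 2}
      (∑ i ∈ Finset.univ.filter (fun i : Fin I => min R E ≤ (i : ℕ)), (lam i) ^ 2) := by
  have hlt : ∀ i : Fin I, (i : ℕ) < E ↔ 0 ≤ lam i := fun i =>
    hE ▸ lt_card_filter_nonneg_iff hmono i
  constructor
  · set μ : Fin I → ℝ := fun i => if (i : ℕ) < min R E then lam i else 0 with hμ
    refine ⟨U * diagonal μ * Uᵀ, ?_, ?_, ?_⟩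
    · have hd : (diagonal μ).PosSemidef := by
        refine PosSemidef.diagonal fun i => ?_
        simp only [hμ, Pi.zero_apply]
        split_ifs with hi
        · exact (hlt i).1 (hi.trans_le (min_le_right _ _))
        · exact le_rfl
      simpa using hd.mul_mul_conjTranspose_same U
    · calc (U * diagonal μ * Uᵀ).rank ≤ (diagonal μ).rank :=
            (rank_mul_le_left _ _).trans (rank_mul_le_right _ _)
        _ = Fintype.card {i // μ i ≠ 0} := rank_diagonal μ
        _ = (Finset.univ.filter fun i => μ i ≠ 0).card := Fintype.card_subtype _
        _ ≤ (Finset.univ.filter fun i : Fin I => (i : ℕ) < R).card := by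
            refine Finset.card_le_card fun i hi => ?_
            simp only [Finset.mem_filter, Finset.mem_univ, true_and, hμ] at hi ⊢
            exact (ite_ne_right_iff.1 hi).1.trans_le (min_le_left _ _)
        _ ≤ R := by rw [Fin.card_filter_val_lt]; exact min_le_right _ _
    · rw [hdecomp, sum_sq_conj_diagonal_sub U U lam μ hU hU, hU, Finset.sum_filter]
      refine Finset.sum_congr rfl fun i _ => ?_
      rw [Finset.sum_eq_single i (fun k _ hk => by simp [one_apply_ne hk.symm]) (by simp)]
      by_cases hi : (i : ℕ) < min R E
      · simp only [hμ, if_pos hi, if_neg (not_le.2 hi)]; simp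
      · simp only [hμ, if_neg hi, if_pos (not_lt.1 hi)]; simp
  · rintro _ ⟨S, hS, hrank, rfl⟩
    set V := (hS.1.eigenvectorUnitary : Matrix (Fin I) (Fin I) ℝ)
    set s := hS.1.eigenvalues
    have hV : Vᵀ * V = 1 := by
      have := Unitary.coe_star_mul_self hS.1.eigenvectorUnitary
      simpa [star_eq_conjTranspose] using this
    have hSdecomp : S = V * diagonal s * Vᵀ := by
      have := hS.1.spectral_theorem
      rw [Unitary.conjStarAlgAut_apply] at this
      simpa [star_eq_conjTranspose, Function.comp_def] using this
    have hs0 : ∀ k, 0 ≤ s k := hS.eigenvalues_nonneg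
    have hcard : (Finset.univ.filter fun k => s k ≠ 0).card ≤ R := by
      rwa [hS.1.rank_eq_card_non_zero_eigs, Fintype.card_subtype] at hrank
    rw [hdecomp, hSdecomp, sum_sq_conj_diagonal_sub U V lam s hU hV]
    set W := Uᵀ * V with hWdef
    have hW : Wᵀ * W = 1 := by
      rw [hWdef, transpose_mul, transpose_transpose, Matrix.mul_assoc, ← Matrix.mul_assoc U,
        mul_eq_one_comm.mp hU, Matrix.one_mul, hV]
    set K := Finset.univ.filter fun k => s k ≠ 0
    have hbound : ∀ i, lam i ^ 2 - (∑ k ∈ K, W i k ^ 2) * max (lam i) 0 ^ 2 ≤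
        ∑ k, (lam i - s k) ^ 2 * W i k ^ 2 := by
      intro i
      calc lam i ^ 2 - (∑ k ∈ K, W i k ^ 2) * max (lam i) 0 ^ 2
          = ∑ k, (lam i ^ 2 - if s k ≠ 0 then max (lam i) 0 ^ 2 else 0) * W i k ^ 2 := by
            simp only [sub_mul, Finset.sum_sub_distrib, ← Finset.mul_sum,
              sum_sq_row_of_orthogonal W hW, mul_one, ite_mul, zero_mul, ← Finset.sum_filter]
            rw [mul_comm]
        _ ≤ _ := by
            refine Finset.sum_le_sum fun k _ => mul_le_mul_of_nonneg_right ?_ (sq_nonneg _)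
            split_ifs with hk
            · rcases le_total 0 (lam i) with h | h
              · rw [max_eq_left h, sub_self]; exact sq_nonneg _
              · rw [max_eq_right h]; nlinarith [hs0 k]
            · rw [not_not.1 hk]; simp
    have hpos : Antitone fun i => max (lam i) 0 ^ 2 := fun i j hij =>
      pow_le_pow_left₀ (le_max_right _ _) (max_le_max_right 0 (hmono hij)) 2
    have hselect := sum_mul_le_sum_initial (R := R) (fun i => max (lam i) 0 ^ 2)
      (fun i => ∑ k ∈ K, W i k ^ 2) hpos (fun i => sq_nonneg _)
      (fun i => Finset.sum_nonneg fun k _ => sq_nonneg _)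
      (fun i => (Finset.sum_le_univ_sum_of_nonneg fun k => sq_nonneg _).trans_eq
        (sum_sq_row_of_orthogonal W hW i))
      (by
        rw [Finset.sum_comm]
        simp only [sum_sq_col_of_orthogonal W hW, Finset.sum_const, nsmul_eq_mul, mul_one]
        exact_mod_cast hcard)
    refine le_trans ?_ (Finset.sum_le_sum fun i _ => hbound i)
    rw [Finset.sum_sub_distrib]
    refine le_trans (le_of_eq ?_) (sub_le_sub_left hselect _)
    rw [← Finset.sum_sub_distrib, Finset.sum_filter]
    refine Finset.sum_congr rfl fun i _ => ?_
    rcases le_or_gt 0 (lam i) with h | h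
    · have hiE := (hlt i).2 h
      by_cases hi : (i : ℕ) < R
      · rw [if_neg (not_le.2 (lt_min hi hiE)), if_pos hi, max_eq_left h, sub_self]
      · rw [if_pos (min_le_of_left_le (not_lt.1 hi)), if_neg hi, sub_zero]
    · have hiE : E ≤ i := not_lt.1 fun hi => h.not_ge ((hlt i).1 hi)
      rw [if_pos (min_le_of_right_le hiE), max_eq_right h.le]
      simp
end

section
/- Let Z^(1), …, Z^(M) be real symmetric I×I matrices and let R ≤ M·I. Then the infimum, over all nonnegative integers R_1, …, R_M with R_1 + … + R_M = R and R_m ≤ I for each m, and over all U^(m) ∈ ℝ^{I×R_m} with (U^(m))ᵀU^(m) = I_{R_m} and all diagonal matrices D^(m) ∈ ℝ^{R_m×R_m}, of Σ_{m=1}^M ‖Z^(m) − U^(m) D^(m) (U^(m))ᵀ‖², equals the sum of the squares of all the eigenvalues in the multiset union (with multiplicity) of the eigenvalues of Z^(1), …, Z^(M), except the R of them with largest absolute value. -/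
open Matrix Finset

section SmallestSum

variable {α : Type*} [Fintype α]

/-- Some index set of size `k` realizes the sum of the `k` smallest values of `a`. -/
lemma exists_finset_sum_eq_take_sort (a : α → ℝ) {k : ℕ} (hk : k ≤ Fintype.card α) :
    ∃ S : Finset α, #S = k ∧ (∀ i ∈ S, ∀ j ∉ S, a i ≤ a j) ∧
      ∑ i ∈ S, a i = (((Finset.univ.val.map a).sort (· ≤ ·)).take k).sum := by
  classical
  set l : List α := (Finset.univ : Finset α).toList.insertionSort (fun i j => a i ≤ a j)
  have : Std.Total (fun i j : α => a i ≤ a j) := ⟨fun i j => le_total _ _⟩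
  have : IsTrans α (fun i j : α => a i ≤ a j) := ⟨fun _ _ _ => le_trans⟩
  have hsorted : l.Pairwise (fun i j => a i ≤ a j) := List.pairwise_insertionSort _ _
  have hperm : l.Perm (Finset.univ : Finset α).toList := List.perm_insertionSort _ _
  have hnodup : l.Nodup := hperm.nodup_iff.2 (Finset.nodup_toList _)
  have hmem : ∀ i, i ∈ l := fun i => hperm.mem_iff.2 (by simp)
  have hlen : l.length = Fintype.card α := by rw [hperm.length_eq]; simp
  have hsort : (Finset.univ.val.map a).sort (· ≤ ·) = l.map a := by
    apply List.Perm.eq_of_pairwise' (r := (· ≤ ·))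
    · exact Multiset.pairwise_sort _ _
    · exact List.pairwise_map.2 hsorted
    · rw [← Multiset.coe_eq_coe, Multiset.sort_eq, ← Multiset.map_coe,
        Multiset.coe_eq_coe.2 hperm, Finset.coe_toList]
  have hsplit := List.take_append_drop k l
  have hnodupTake : (l.take k).Nodup := hnodup.sublist (List.take_sublist _ _)
  refine ⟨(l.take k).toFinset, ?_, ?_, ?_⟩
  · rw [List.toFinset_card_of_nodup hnodupTake, List.length_take, hlen, min_eq_left hk]
  · intro i hi j hj
    rw [List.mem_toFinset] at hi hj
    have hj' : j ∈ l.drop k := by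
      have := hmem j
      rw [← hsplit, List.mem_append] at this
      exact this.resolve_left hj
    rw [← hsplit, List.pairwise_append] at hsorted
    exact hsorted.2.2 i hi j hj'
  · rw [hsort, ← List.map_take, List.sum_toFinset _ hnodupTake]

/-- A fractional selection of total weight `#S` costs at least as much as selecting a set `S`
of smallest values. -/
lemma sum_le_sum_mul_of_sum_eq_card (a c : α → ℝ) (S : Finset α) (ha : ∀ i, 0 ≤ a i)
    (hS : ∀ i ∈ S, ∀ j ∉ S, a i ≤ a j) (hc₀ : ∀ i, 0 ≤ c i) (hc₁ : ∀ i, c i ≤ 1)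
    (hc : ∑ i, c i = #S) : ∑ i ∈ S, a i ≤ ∑ i, a i * c i := by
  classical
  obtain ⟨t, ht₁, ht₂⟩ : ∃ t, (∀ i ∈ S, a i ≤ t) ∧ ∀ j ∉ S, t ≤ a j := by
    rcases S.eq_empty_or_nonempty with rfl | hne
    · exact ⟨0, by simp, fun j _ => ha j⟩
    · exact ⟨S.sup' hne a, fun i hi => Finset.le_sup' a hi,
        fun j hj => Finset.sup'_le hne a fun i hi => hS i hi j hj⟩
  have hnonneg : 0 ≤ ∑ i, (a i - t) * (c i - if i ∈ S then 1 else 0) := by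
    refine Finset.sum_nonneg fun i _ => ?_
    by_cases hi : i ∈ S
    · simp only [hi, if_true]
      exact mul_nonneg_of_nonpos_of_nonpos (by linarith [ht₁ i hi]) (by linarith [hc₁ i])
    · simp only [hi, if_false, sub_zero]
      exact mul_nonneg (by linarith [ht₂ i hi]) (hc₀ i)
  have hexpand : ∑ i, (a i - t) * (c i - if i ∈ S then 1 else 0)
      = ∑ i, a i * c i - ∑ i ∈ S, a i - t * (∑ i, c i - #S) := by
    simp only [sub_mul, mul_sub, Finset.sum_sub_distrib, mul_ite, mul_one, mul_zero,
      Finset.sum_ite_mem, Finset.univ_inter, ← Finset.mul_sum, Finset.sum_const, nsmul_eq_mul]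
    ring
  rw [hexpand, hc] at hnonneg
  linarith

end SmallestSum

section Frobenius

variable {n r : Type*} [Fintype n] [Fintype r]

lemma sum_sq_eq_trace_transpose_mul (A : Matrix n r ℝ) :
    ∑ i, ∑ j, A i j ^ 2 = (Aᵀ * A).trace := by
  simp only [Matrix.trace, Matrix.diag, Matrix.mul_apply, Matrix.transpose_apply, ← sq]
  exact Finset.sum_comm

variable [DecidableEq r]

lemma sum_sum_sq_eq_card (V : Matrix n r ℝ) (hV : Vᵀ * V = 1) :
    ∑ i, ∑ k, V i k ^ 2 = Fintype.card r := by
  rw [sum_sq_eq_trace_transpose_mul, hV, trace_one]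

/-- Rows of a matrix with orthonormal columns have norm at most one. -/
lemma sum_row_sq_le_one (V : Matrix n r ℝ) (hV : Vᵀ * V = 1) (i : n) :
    ∑ k, V i k ^ 2 ≤ 1 := by
  set w := ∑ k, V i k ^ 2 with hw
  have hidem : (V * Vᵀ) * (V * Vᵀ) = V * Vᵀ := by
    rw [Matrix.mul_assoc, ← Matrix.mul_assoc Vᵀ, hV, Matrix.one_mul]
  have hdiag : (V * Vᵀ) i i = w := by
    simp only [Matrix.mul_apply, transpose_apply, ← sq, hw]
  have hsymm : ∀ j, (V * Vᵀ) j i = (V * Vᵀ) i j := fun j => by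
    simp only [Matrix.mul_apply, transpose_apply, mul_comm]
  have hsum : ∑ j, (V * Vᵀ) i j ^ 2 = w := by
    rw [← hdiag, ← congrFun (congrFun hidem i) i, Matrix.mul_apply]
    exact Finset.sum_congr rfl fun j _ => by rw [hsymm j, sq]
  have hle : w ^ 2 ≤ w := by
    calc w ^ 2 = (V * Vᵀ) i i ^ 2 := by rw [hdiag]
      _ ≤ ∑ j, (V * Vᵀ) i j ^ 2 :=
        Finset.single_le_sum (f := fun j => (V * Vᵀ) i j ^ 2) (fun j _ => sq_nonneg _)
          (Finset.mem_univ i)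
      _ = w := hsum
  nlinarith

variable [DecidableEq n]

lemma sum_sq_conj_eq (P A : Matrix n n ℝ) (hP : Pᵀ * P = 1) :
    ∑ i, ∑ j, ((P * A * Pᵀ) i j) ^ 2 = ∑ i, ∑ j, A i j ^ 2 := by
  rw [sum_sq_eq_trace_transpose_mul, sum_sq_eq_trace_transpose_mul]
  have hconj : (P * A * Pᵀ)ᵀ * (P * A * Pᵀ) = P * (Aᵀ * (Pᵀ * P) * A * Pᵀ) := by
    simp only [transpose_mul, transpose_transpose, Matrix.mul_assoc]
  rw [hconj, trace_mul_comm, hP, Matrix.mul_one, Matrix.mul_assoc, hP, Matrix.mul_one]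

/-- The residual of `diagonal lam` after subtracting `V D Vᵀ`, in terms of the row weights
of `V`. -/
lemma sum_sq_diagonal_sub_eq (lam : n → ℝ) (V : Matrix n r ℝ) (D : Matrix r r ℝ)
    (hV : Vᵀ * V = 1) (hD : D.IsDiag) :
    ∑ i, ∑ j, ((diagonal lam - V * D * Vᵀ) i j) ^ 2
      = ∑ i, lam i ^ 2 * (1 - ∑ k, V i k ^ 2)
        + ∑ i, ∑ k, ((diagonal lam * V - V * D) i k) ^ 2 := by
  have hDt : Dᵀ = D := hD.isSymm
  have hweights : ∑ i, lam i ^ 2 * (1 - ∑ k, V i k ^ 2)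
      = (diagonal lam * diagonal lam).trace
        - ((diagonal lam * diagonal lam) * (V * Vᵀ)).trace := by
    simp only [diagonal_mul_diagonal, Matrix.trace, Matrix.diag, diagonal_mul,
      diagonal_apply_eq, ← Finset.sum_sub_distrib]
    refine Finset.sum_congr rfl fun i _ => ?_
    simp only [Matrix.mul_apply, transpose_apply, ← sq]
    ring
  rw [sum_sq_eq_trace_transpose_mul, sum_sq_eq_trace_transpose_mul, hweights]
  have hLt : (diagonal lam)ᵀ = diagonal lam := diagonal_transpose _
  generalize diagonal lam = L at *
  have hcross : (L * (V * (D * Vᵀ))).trace = (Vᵀ * (L * (V * D))).trace := by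
    rw [trace_mul_comm Vᵀ]
    simp only [Matrix.mul_assoc]
  have hcross' : (V * (D * (Vᵀ * L))).trace = (D * (Vᵀ * (L * V))).trace := by
    rw [trace_mul_comm]
    simp only [Matrix.mul_assoc]
  have hsq : (V * (D * (Vᵀ * (V * (D * Vᵀ))))).trace = (D * (Vᵀ * (V * D))).trace := by
    rw [trace_mul_comm, ← Matrix.mul_assoc Vᵀ, hV]
    simp only [Matrix.mul_assoc, hV, Matrix.one_mul, Matrix.mul_one]
    rw [← Matrix.mul_assoc Vᵀ, hV, Matrix.one_mul]
  have hlead : (Vᵀ * (L * (L * V))).trace = (L * (L * (V * Vᵀ))).trace := by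
    rw [trace_mul_comm]
    simp only [Matrix.mul_assoc]
  simp only [transpose_sub, transpose_mul, transpose_transpose, hLt, hDt, Matrix.sub_mul,
    Matrix.mul_sub, trace_sub, Matrix.mul_assoc, hcross, hcross', hsq, hlead]
  ring

/-- The residual of `P Λ Pᵀ` after subtracting `(P V) D (P V)ᵀ`, in terms of the row
weights of `V`. -/
lemma sum_sq_sub_eq (P : Matrix n n ℝ) (lam : n → ℝ) (V : Matrix n r ℝ) (D : Matrix r r ℝ)
    (hP : Pᵀ * P = 1) (hV : Vᵀ * V = 1) (hD : D.IsDiag) :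
    ∑ i, ∑ j, ((P * diagonal lam * Pᵀ - (P * V) * D * (P * V)ᵀ) i j) ^ 2
      = ∑ i, lam i ^ 2 * (1 - ∑ k, V i k ^ 2)
        + ∑ i, ∑ k, ((diagonal lam * V - V * D) i k) ^ 2 := by
  have hres : P * diagonal lam * Pᵀ - (P * V) * D * (P * V)ᵀ
      = P * (diagonal lam - V * D * Vᵀ) * Pᵀ := by
    simp only [transpose_mul, Matrix.mul_sub, Matrix.sub_mul, Matrix.mul_assoc]
  rw [hres, sum_sq_conj_eq _ _ hP, sum_sq_diagonal_sub_eq _ _ _ hV hD]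

lemma diagonal_mul_one_submatrix (lam : n → ℝ) (e : r → n) :
    diagonal lam * (1 : Matrix n n ℝ).submatrix id e
      = (1 : Matrix n n ℝ).submatrix id e * diagonal (lam ∘ e) := by
  ext i k
  simp only [diagonal_mul, mul_diagonal, submatrix_apply, id, Matrix.one_apply, Function.comp]
  split_ifs with h <;> simp [h]

end Frobenius

/-- Coordinate columns selected by an injection are orthonormal. -/
lemma transpose_one_submatrix_mul_self {n r : Type*} [Fintype n] [DecidableEq n]
    [DecidableEq r] {e : r → n} (he : Function.Injective e) :
    ((1 : Matrix n n ℝ).submatrix id e)ᵀ * (1 : Matrix n n ℝ).submatrix id e = 1 := by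
  ext k l
  simp [Matrix.mul_apply, Matrix.one_apply, he.eq_iff]

lemma map_sum_univ_val_map_eq {ι κ β γ : Type*} [Fintype ι] [Fintype κ] (f : ι → κ → β)
    (g : β → γ) : (∑ m, Finset.univ.val.map (f m) : Multiset β).map g
      = (Finset.univ : Finset (ι × κ)).val.map fun p => g (f p.1 p.2) := by
  rw [← Multiset.coe_mapAddMonoidHom, map_sum, Multiset.coe_mapAddMonoidHom]
  simp only [Multiset.map_map, Function.comp_def]
  rw [← Multiset.sum_map_singleton (Multiset.map _ (Finset.univ : Finset (ι × κ)).val),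
    Multiset.map_map]
  change _ = ∑ p : ι × κ, {g (f p.1 p.2)}
  rw [Fintype.sum_prod_type]
  refine Finset.sum_congr rfl fun m _ => ?_
  rw [← Multiset.sum_map_singleton (Multiset.map _ _), Multiset.map_map]
  rfl

/-- The infimum of `Σₘ ‖Z⁽ᵐ⁾ − U⁽ᵐ⁾ D⁽ᵐ⁾ (U⁽ᵐ⁾)ᵀ‖²` over partitions `R₁ + ⋯ + R_M = R`
(with `Rₘ ≤ I`), matrices with orthonormal columns, and diagonal `D⁽ᵐ⁾` equals the sum of
squares of all eigenvalues in the multiset union except the `R` of largest absolute value. -/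
theorem stmt13 (M I R : ℕ) (hR : R ≤ M * I)
    (Z P : Fin M → Matrix (Fin I) (Fin I) ℝ) (lam : Fin M → Fin I → ℝ)
    (hsym : ∀ m, (Z m)ᵀ = Z m)
    (hP : ∀ m, (P m)ᵀ * P m = 1)
    (hZ : ∀ m, Z m = P m * Matrix.diagonal (lam m) * (P m)ᵀ) :
    IsGLB {v : ℝ | ∃ Rm : Fin M → ℕ, (∑ m, Rm m) = R ∧ (∀ m, Rm m ≤ I) ∧
        ∃ Us : ∀ m : Fin M, Matrix (Fin I) (Fin (Rm m)) ℝ,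
          ∃ Ds : ∀ m : Fin M, Matrix (Fin (Rm m)) (Fin (Rm m)) ℝ,
          (∀ m, (Us m)ᵀ * Us m = 1) ∧ (∀ m, (Ds m).IsDiag) ∧
          v = ∑ m, ∑ i, ∑ j, ((Z m - Us m * Ds m * (Us m)ᵀ) i j) ^ 2}
      (((((∑ m, Finset.univ.val.map (lam m) : Multiset ℝ)).map (fun x => x ^ 2)).sort
          (· ≤ ·)).take (M * I - R)).sum := by
  have hcard : M * I - R ≤ Fintype.card (Fin M × Fin I) := by simp
  obtain ⟨S, hScard, hSle, hSsum⟩ :=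
    exists_finset_sum_eq_take_sort (fun p : Fin M × Fin I => lam p.1 p.2 ^ 2) hcard
  rw [map_sum_univ_val_map_eq, ← hSsum]
  apply IsLeast.isGLB
  constructor
  · let T : Fin M → Finset (Fin I) := fun m => {i | (m, i) ∉ S}
    let e : ∀ m, Fin #(T m) → Fin I := fun m => (T m).orderEmbOfFin rfl
    have he : ∀ m, Function.Injective (e m) := fun m => ((T m).orderEmbOfFin rfl).injective
    let E : ∀ m, Matrix (Fin I) (Fin #(T m)) ℝ := fun m => (1 : Matrix _ _ ℝ).submatrix id (e m)
    have hE : ∀ m, (E m)ᵀ * E m = 1 := fun m => transpose_one_submatrix_mul_self (he m)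
    have hweight : ∀ m i, 1 - ∑ k, E m i k ^ 2 = if (m, i) ∈ S then 1 else 0 := by
      intro m i
      have hsum : ∑ k, E m i k ^ 2 = ∑ j ∈ T m, if i = j then (1 : ℝ) else 0 := by
        have hmap := Finset.sum_map Finset.univ ((T m).orderEmbOfFin rfl).toEmbedding
          fun j => if i = j then (1 : ℝ) else 0
        rw [Finset.map_orderEmbOfFin_univ] at hmap
        rw [hmap]
        refine Finset.sum_congr rfl fun k _ => ?_
        simp [E, e, Matrix.one_apply]
      rw [hsum, Finset.sum_ite_eq]
      by_cases h : (m, i) ∈ S <;> simp [T, h]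
    have hTcard : ∑ m, #(T m) = R := by
      have hcompl : ∑ m, #(T m) = #Sᶜ := by
        simp only [T, Finset.compl_eq_univ_sdiff, Finset.sdiff_eq_filter, Finset.card_filter,
          Fintype.sum_prod_type]
      rw [hcompl, Finset.card_compl, hScard, Fintype.card_prod, Fintype.card_fin,
        Fintype.card_fin, Nat.sub_sub_self hR]
    refine ⟨fun m => #(T m), hTcard, fun m => (Finset.card_le_univ _).trans_eq (by simp),
      fun m => P m * E m, fun m => diagonal (lam m ∘ e m), fun m => ?_,
      fun m => isDiag_diagonal _, ?_⟩
    · rw [transpose_mul, Matrix.mul_assoc, ← Matrix.mul_assoc _ (P m), hP, Matrix.one_mul, hE]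
    · have hres : ∀ m, diagonal (lam m) * E m - E m * diagonal (lam m ∘ e m) = 0 := fun m =>
        sub_eq_zero.2 (diagonal_mul_one_submatrix _ _)
      simp only [hZ, sum_sq_sub_eq _ _ _ _ (hP _) (hE _) (isDiag_diagonal _), hres, hweight,
        Matrix.zero_apply]
      have hS : ∑ p ∈ S, lam p.1 p.2 ^ 2 = ∑ p, if p ∈ S then lam p.1 p.2 ^ 2 else 0 := by
        rw [Finset.sum_ite_mem, Finset.univ_inter]
      rw [hS, Fintype.sum_prod_type]
      simp
  · rintro v ⟨Rm, hRm, -, Us, Ds, hU, hD, rfl⟩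
    have hP' : ∀ m, P m * (P m)ᵀ = 1 := fun m => mul_eq_one_comm.1 (hP m)
    let V : ∀ m, Matrix (Fin I) (Fin (Rm m)) ℝ := fun m => (P m)ᵀ * Us m
    have hUV : ∀ m, Us m = P m * V m := fun m => by
      rw [← Matrix.mul_assoc, hP', Matrix.one_mul]
    have hV : ∀ m, (V m)ᵀ * V m = 1 := fun m => by
      rw [transpose_mul, transpose_transpose, Matrix.mul_assoc, ← Matrix.mul_assoc (P m), hP',
        Matrix.one_mul, hU]
    have htotal : ∑ p : Fin M × Fin I, (1 - ∑ k, V p.1 p.2 k ^ 2) = #S := by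
      simp only [Fintype.sum_prod_type, Finset.sum_sub_distrib, sum_sum_sq_eq_card _ (hV _),
        hScard, Nat.cast_sub hR]
      simp [← hRm]
    calc ∑ p ∈ S, lam p.1 p.2 ^ 2
        ≤ ∑ p : Fin M × Fin I, lam p.1 p.2 ^ 2 * (1 - ∑ k, V p.1 p.2 k ^ 2) :=
          sum_le_sum_mul_of_sum_eq_card _ _ S (fun _ => sq_nonneg _) hSle
            (fun p => sub_nonneg.2 (sum_row_sq_le_one _ (hV _) _))
            (fun p => sub_le_self _ (Finset.sum_nonneg fun _ _ => sq_nonneg _)) htotal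
      _ = ∑ m, ∑ i, lam m i ^ 2 * (1 - ∑ k, V m i k ^ 2) := Fintype.sum_prod_type _
      _ ≤ ∑ m, ∑ i, ∑ j, ((Z m - Us m * Ds m * (Us m)ᵀ) i j) ^ 2 := by
          refine Finset.sum_le_sum fun m _ => ?_
          rw [hZ m, hUV m, sum_sq_sub_eq _ _ _ _ (hP m) (hV m) (hD m)]
          exact le_add_of_nonneg_right
            (Finset.sum_nonneg fun _ _ => Finset.sum_nonneg fun _ _ => sq_nonneg _)
end
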